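/- arXiv:math/9808099 — 4 statements merged into one kernel-verified Lean document; each statement's English description precedes it below -/
import Mathlib

section
/- (Lemma 2-19.) Let γ : ℝ → ℂ and φ : ℝ → ℝ be smooth (C^∞) with deriv γ s = exp(i·φ(s)) for all s (the arc-length/reality condition |γ'| = 1), and suppose deriv φ is 2π-periodic, i.e. φ'(s + 2π) = φ'(s) for all s. Then ∫_0^{2π} {γ,s}_SD(s) ds = (1/2)·∫_0^{2π} (φ'(s))² ds; in particular the Euler–Bernoulli energy ∫_0^{2π} {γ,s}_SD(s) ds is a non-negative real number. -/
open scoped Real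

/-- The Schwarz derivative of a curve `γ : ℝ → ℂ`. -/
noncomputable def schwarzDeriv (γ : ℝ → ℂ) (s : ℝ) : ℂ :=
  deriv (fun x => deriv (deriv γ) x / deriv γ x) s
    - (1 / 2) * (deriv (deriv γ) s / deriv γ s) ^ 2

/-- The logarithmic derivative `γ''/γ'` of the tangent of an arc-length curve is `i φ'`. -/
theorem deriv_deriv_div_deriv_of_arc {γ : ℝ → ℂ} {φ : ℝ → ℝ} (hφ : Differentiable ℝ φ)
    (harc : ∀ s : ℝ, deriv γ s = Complex.exp (Complex.I * (φ s : ℂ))) (s : ℝ) :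
    deriv (deriv γ) s / deriv γ s = Complex.I * ((deriv φ s : ℝ) : ℂ) := by
  have h : HasDerivAt (fun x : ℝ => Complex.exp (Complex.I * (φ x : ℂ)))
      (Complex.exp (Complex.I * (φ s : ℂ)) * (Complex.I * ((deriv φ s : ℝ) : ℂ))) s :=
    ((hφ s).hasDerivAt.ofReal_comp.const_mul Complex.I).cexp
  rw [funext harc, h.deriv, mul_div_cancel_left₀ _ (Complex.exp_ne_zero _)]

/-- The Schwarz derivative of an arc-length curve in terms of its tangential angle. -/
theorem schwarzDeriv_of_arc {γ : ℝ → ℂ} {φ : ℝ → ℝ} (hφ : Differentiable ℝ φ)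
    (hφ' : Differentiable ℝ (deriv φ))
    (harc : ∀ s : ℝ, deriv γ s = Complex.exp (Complex.I * (φ s : ℂ))) (s : ℝ) :
    schwarzDeriv γ s
      = Complex.I * ((deriv (deriv φ) s : ℝ) : ℂ) + (((1 / 2) * deriv φ s ^ 2 : ℝ) : ℂ) := by
  have h : HasDerivAt (fun x : ℝ => Complex.I * ((deriv φ x : ℝ) : ℂ))
      (Complex.I * ((deriv (deriv φ) s : ℝ) : ℂ)) s :=
    (hφ' s).hasDerivAt.ofReal_comp.const_mul Complex.I
  simp only [schwarzDeriv, deriv_deriv_div_deriv_of_arc hφ harc, h.deriv, mul_pow, Complex.I_sq]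
  push_cast
  ring

/-- Lemma 2-19: under the arc-length condition `γ' = exp(iφ)` with `φ' ` 2π-periodic,
the Euler–Bernoulli energy `∫₀^{2π} {γ,s}_SD ds` equals `½∫₀^{2π} (φ')² ds`, and in
particular is a non-negative real number. -/
theorem energy_nonneg_real (γ : ℝ → ℂ) (φ : ℝ → ℝ)
    (hγ : ContDiff ℝ (⊤ : ℕ∞) γ) (hφ : ContDiff ℝ (⊤ : ℕ∞) φ)
    (harc : ∀ s : ℝ, deriv γ s = Complex.exp (Complex.I * (φ s : ℂ)))
    (hper : ∀ s : ℝ, deriv φ (s + 2 * π) = deriv φ s) :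
    (∫ s in (0:ℝ)..(2 * π), schwarzDeriv γ s)
        = (((1 / 2) * ∫ s in (0:ℝ)..(2 * π), (deriv φ s) ^ 2 : ℝ) : ℂ) ∧
      0 ≤ (1 / 2) * ∫ s in (0:ℝ)..(2 * π), (deriv φ s) ^ 2 := by
  have h1 : ContDiff ℝ (⊤ : ℕ∞) (deriv φ) := (contDiff_infty_iff_deriv.1 hφ).2
  have hd1 : Differentiable ℝ (deriv φ) := (contDiff_infty_iff_deriv.1 h1).1
  have hc2 : Continuous (deriv (deriv φ)) := (contDiff_infty_iff_deriv.1 h1).2.continuous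
  have hint : ∫ s in (0:ℝ)..(2 * π), deriv (deriv φ) s = 0 := by
    rw [intervalIntegral.integral_deriv_eq_sub (fun x _ => hd1 x) (hc2.intervalIntegrable _ _)]
    simpa [sub_eq_zero] using hper 0
  refine ⟨?_, mul_nonneg (by norm_num)
    (intervalIntegral.integral_nonneg (by positivity) fun s _ => sq_nonneg _)⟩
  simp_rw [schwarzDeriv_of_arc (contDiff_infty_iff_deriv.1 hφ).1 hd1 harc]
  rw [intervalIntegral.integral_add, intervalIntegral.integral_const_mul,
    intervalIntegral.integral_ofReal, intervalIntegral.integral_ofReal, hint,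
    intervalIntegral.integral_const_mul]
  · simp
  · exact (continuous_const.mul (Complex.continuous_ofReal.comp hc2)).intervalIntegrable _ _
  · exact (Complex.continuous_ofReal.comp
      (continuous_const.mul (h1.continuous.pow 2))).intervalIntegrable _ _
end

section
/- (First variation of the Schwarz derivative, from the proof of Proposition 2-13.) Let γ, v : ℝ → ℂ be smooth (C^∞) and let s ∈ ℝ with deriv γ s ≠ 0. Then the function ε ↦ {γ + ε·v, s}_SD(s) is differentiable at ε = 0 with derivative v'''(s)/γ'(s) − (γ'''(s)/γ'(s)²)·v'(s) − 3·(γ''(s)/γ'(s))·( v''(s)/γ'(s) − (γ''(s)/γ'(s)²)·v'(s) ). -/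
/-- Smoothness of the derivative of a smooth curve. -/
theorem contDiff_infty_deriv {f : ℝ → ℂ} (hf : ContDiff ℝ (⊤ : ℕ∞) f) :
    ContDiff ℝ (⊤ : ℕ∞) (deriv f) :=
  (contDiff_infty_iff_deriv.1 hf).2

/-- Differentiation is linear along the line `γ + c v` of smooth curves. -/
theorem deriv_add_const_mul_curve {γ v : ℝ → ℂ} (hγ : ContDiff ℝ (⊤ : ℕ∞) γ)
    (hv : ContDiff ℝ (⊤ : ℕ∞) v) (c : ℂ) :
    deriv (fun x => γ x + c * v x) = fun x => deriv γ x + c * deriv v x := by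
  funext x
  have h₁ := ((contDiff_infty_iff_deriv.1 hγ).1 x).hasDerivAt
  have h₂ := ((contDiff_infty_iff_deriv.1 hv).1 x).hasDerivAt
  exact (h₁.add (h₂.const_mul c)).deriv

/-- The Schwarz derivative of a smooth curve as a rational function of its derivatives. -/
theorem schwarzDeriv_eq {γ : ℝ → ℂ} (hγ : ContDiff ℝ (⊤ : ℕ∞) γ) {s : ℝ}
    (h : deriv γ s ≠ 0) :
    schwarzDeriv γ s = deriv (deriv (deriv γ)) s / deriv γ s
      - (3 / 2) * (deriv (deriv γ) s / deriv γ s) ^ 2 := by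
  have h₁ := contDiff_infty_deriv hγ
  have h₂ := contDiff_infty_deriv h₁
  have d₁ := ((contDiff_infty_iff_deriv.1 h₁).1 s).hasDerivAt
  have d₂ := ((contDiff_infty_iff_deriv.1 h₂).1 s).hasDerivAt
  have d : deriv (fun x => deriv (deriv γ) x / deriv γ x) s = _ := (d₂.div d₁ h).deriv
  rw [schwarzDeriv, d]
  field_simp
  ring

/-- First variation of the Schwarz derivative (from the proof of Proposition 2-13):
the map `ε ↦ {γ + εv, s}_SD(s)` is differentiable at `ε = 0` with the stated derivative. -/
theorem schwarzDeriv_first_variation (γ v : ℝ → ℂ)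
    (hγ : ContDiff ℝ (⊤ : ℕ∞) γ) (hv : ContDiff ℝ (⊤ : ℕ∞) v) (s : ℝ) (h : deriv γ s ≠ 0) :
    HasDerivAt (fun ε : ℝ => schwarzDeriv (fun x => γ x + (ε : ℂ) * v x) s)
      (deriv (deriv (deriv v)) s / deriv γ s
        - (deriv (deriv (deriv γ)) s / (deriv γ s) ^ 2) * deriv v s
        - 3 * (deriv (deriv γ) s / deriv γ s) *
            (deriv (deriv v) s / deriv γ s
              - (deriv (deriv γ) s / (deriv γ s) ^ 2) * deriv v s)) 0 := by
  have hγ₁ := contDiff_infty_deriv hγ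
  have hγ₂ := contDiff_infty_deriv hγ₁
  have hv₁ := contDiff_infty_deriv hv
  have hv₂ := contDiff_infty_deriv hv₁
  have line (a b : ℂ) : HasDerivAt (fun ε : ℝ => a + (ε : ℂ) * b) b 0 := by
    simpa using (((hasDerivAt_id (0 : ℝ)).ofReal_comp).mul_const b).const_add a
  have hne : ∀ᶠ ε : ℝ in nhds 0, deriv γ s + (ε : ℂ) * deriv v s ≠ 0 :=
    (line (deriv γ s) (deriv v s)).continuousAt.eventually_ne (by simpa using h)
  have h0 : deriv γ s + ((0 : ℝ) : ℂ) * deriv v s ≠ 0 := by simpa using h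
  have l₁ := line (deriv γ s) (deriv v s)
  have l₂ := line (deriv (deriv γ) s) (deriv (deriv v) s)
  have l₃ := line (deriv (deriv (deriv γ)) s) (deriv (deriv (deriv v)) s)
  have key := (l₃.div l₁ h0).sub (((l₂.div l₁ h0).pow 2).const_mul (3 / 2 : ℂ))
  refine (key.congr_of_eventuallyEq ?_).congr_deriv ?_
  · filter_upwards [hne] with ε hε
    have e₁ := deriv_add_const_mul_curve hγ hv (ε : ℂ)
    have e₂ := deriv_add_const_mul_curve hγ₁ hv₁ (ε : ℂ)
    have e₃ := deriv_add_const_mul_curve hγ₂ hv₂ (ε : ℂ)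
    rw [schwarzDeriv_eq (hγ.add (contDiff_const.mul hv)) (by rw [e₁]; exact hε), e₁, e₂, e₃]
    rfl
  · simp
    field_simp
end

section
/- (Lemma 3-6 (1)–(2), evolution of the potential.) Let ψ₂, A, B : ℝ × ℝ → ℂ be smooth (C^∞) functions of (s,t) with ψ₂(s,t) ≠ 0 for all (s,t), satisfying ∂_s B = −2A and ∂_t ψ₂(s,t) = A(s,t)·ψ₂(s,t) + B(s,t)·∂_s ψ₂(s,t) for all (s,t). Define u := −(∂_s² ψ₂)/ψ₂. Then for all (s,t): ∂_t u = (1/2)·∂_s³ B + 2·u·∂_s B + (∂_s u)·B, i.e. ∂_t u = (1/2)·(∂_s³ + 2u·∂_s + 2(∂_s u))B with the convention that in the last term the operator 2∂_s u acts as multiplication by 2(∂_s u) plus 2u∂_s combined as 2u·∂_sB + 2∂_s(u·B) − 2u·∂_sB... explicitly: ∂_t u(s,t) = (1/2)·∂_s³B(s,t) + 2·u(s,t)·∂_sB(s,t) + ∂_su(s,t)·B(s,t). -/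
/-- Partial derivative with respect to the first (space) variable. -/
noncomputable def pderivS (f : ℝ × ℝ → ℂ) : ℝ × ℝ → ℂ :=
  fun p => deriv (fun x => f (x, p.2)) p.1

/-- Partial derivative with respect to the second (time) variable. -/
noncomputable def pderivT (f : ℝ × ℝ → ℂ) : ℝ × ℝ → ℂ :=
  fun p => deriv (fun y => f (p.1, y)) p.2

open scoped ContDiff

theorem DifferentiableAt.hasDerivAt_pderivS {f : ℝ × ℝ → ℂ} {p : ℝ × ℝ}
    (hf : DifferentiableAt ℝ f p) : HasDerivAt (fun x => f (x, p.2)) (pderivS f p) p.1 :=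
  (DifferentiableAt.comp p.1 (f := fun x : ℝ => (x, p.2)) hf (by fun_prop)).hasDerivAt

theorem DifferentiableAt.hasDerivAt_pderivT {f : ℝ × ℝ → ℂ} {p : ℝ × ℝ}
    (hf : DifferentiableAt ℝ f p) : HasDerivAt (fun y => f (p.1, y)) (pderivT f p) p.2 :=
  (DifferentiableAt.comp p.2 (f := fun y : ℝ => (p.1, y)) hf (by fun_prop)).hasDerivAt

theorem pderivS_eq_fderiv {f : ℝ × ℝ → ℂ} (hf : Differentiable ℝ f) :
    pderivS f = fun p => fderiv ℝ f p (1, 0) := by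
  funext p
  exact ((hf p).hasFDerivAt.comp_hasDerivAt (f := fun x : ℝ => (x, p.2)) p.1
    ((hasDerivAt_id p.1).prodMk (hasDerivAt_const p.1 p.2))).deriv

theorem pderivT_eq_fderiv {f : ℝ × ℝ → ℂ} (hf : Differentiable ℝ f) :
    pderivT f = fun p => fderiv ℝ f p (0, 1) := by
  funext p
  exact ((hf p).hasFDerivAt.comp_hasDerivAt (f := fun y : ℝ => (p.1, y)) p.2
    ((hasDerivAt_const p.2 p.1).prodMk (hasDerivAt_id p.2))).deriv

theorem ContDiff.pderivS {f : ℝ × ℝ → ℂ} (hf : ContDiff ℝ ∞ f) : ContDiff ℝ ∞ (pderivS f) := by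
  rw [pderivS_eq_fderiv (hf.differentiable (by simp))]
  exact (hf.fderiv_right (by simp)).clm_apply contDiff_const

theorem ContDiff.pderivT {f : ℝ × ℝ → ℂ} (hf : ContDiff ℝ ∞ f) : ContDiff ℝ ∞ (pderivT f) := by
  rw [pderivT_eq_fderiv (hf.differentiable (by simp))]
  exact (hf.fderiv_right (by simp)).clm_apply contDiff_const

theorem pderivT_pderivS_comm {f : ℝ × ℝ → ℂ} (hf : ContDiff ℝ ∞ f) :
    pderivT (pderivS f) = pderivS (pderivT f) := by
  have hd : Differentiable ℝ f := hf.differentiable (by simp)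
  have hd' : Differentiable ℝ (fderiv ℝ f) :=
    (hf.fderiv_right (m := ∞) (by simp)).differentiable (by simp)
  rw [pderivT_eq_fderiv (hf.pderivS.differentiable (by simp)),
    pderivS_eq_fderiv (hf.pderivT.differentiable (by simp)),
    pderivS_eq_fderiv hd, pderivT_eq_fderiv hd]
  funext p
  have hsymm : IsSymmSndFDerivAt ℝ f p := hf.contDiffAt.isSymmSndFDerivAt
    (by simpa using WithTop.coe_le_coe.2 (le_top : (2 : ℕ∞) ≤ ⊤))
  rw [fderiv_clm_apply (hd' p) (differentiableAt_const _),
    fderiv_clm_apply (hd' p) (differentiableAt_const _)]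
  simpa using hsymm (0, 1) (1, 0)

theorem pderivS_add {f g : ℝ × ℝ → ℂ} (hf : Differentiable ℝ f) (hg : Differentiable ℝ g) :
    pderivS (fun p => f p + g p) = fun p => pderivS f p + pderivS g p :=
  funext fun p => ((hf p).hasDerivAt_pderivS.add (hg p).hasDerivAt_pderivS).deriv

theorem pderivS_mul {f g : ℝ × ℝ → ℂ} (hf : Differentiable ℝ f) (hg : Differentiable ℝ g) :
    pderivS (fun p => f p * g p) = fun p => pderivS f p * g p + f p * pderivS g p :=
  funext fun p => ((hf p).hasDerivAt_pderivS.mul (hg p).hasDerivAt_pderivS).deriv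

theorem pderivS_const_mul (c : ℂ) {f : ℝ × ℝ → ℂ} (hf : Differentiable ℝ f) :
    pderivS (fun p => c * f p) = fun p => c * pderivS f p :=
  funext fun p => ((hf p).hasDerivAt_pderivS.const_mul c).deriv

theorem pderivS_neg_div {f g : ℝ × ℝ → ℂ} {p : ℝ × ℝ} (hf : DifferentiableAt ℝ f p)
    (hg : DifferentiableAt ℝ g p) (h : g p ≠ 0) :
    pderivS (fun q => -f q / g q) p = (-pderivS f p * g p - -f p * pderivS g p) / g p ^ 2 :=
  (hf.hasDerivAt_pderivS.neg.div hg.hasDerivAt_pderivS h).deriv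

theorem pderivT_neg_div {f g : ℝ × ℝ → ℂ} {p : ℝ × ℝ} (hf : DifferentiableAt ℝ f p)
    (hg : DifferentiableAt ℝ g p) (h : g p ≠ 0) :
    pderivT (fun q => -f q / g q) p = (-pderivT f p * g p - -f p * pderivT g p) / g p ^ 2 :=
  (hf.hasDerivAt_pderivT.neg.div hg.hasDerivAt_pderivT h).deriv

/-- Lemma 3-6 (1)–(2): evolution of the potential `u = −ψ₂''/ψ₂` under an isometric
deformation `∂_t ψ₂ = A ψ₂ + B ∂_s ψ₂` with `∂_s B = −2A`:
`∂_t u = ½ ∂_s³ B + 2u ∂_s B + (∂_s u) B`. -/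
theorem potential_evolution (ψ₂ A B : ℝ × ℝ → ℂ)
    (h₂ : ContDiff ℝ (⊤ : ℕ∞) ψ₂) (hA : ContDiff ℝ (⊤ : ℕ∞) A) (hB : ContDiff ℝ (⊤ : ℕ∞) B)
    (hne : ∀ p : ℝ × ℝ, ψ₂ p ≠ 0)
    (hconstraint : ∀ p : ℝ × ℝ, pderivS B p = -2 * A p)
    (hflow : ∀ p : ℝ × ℝ, pderivT ψ₂ p = A p * ψ₂ p + B p * pderivS ψ₂ p) :
    ∀ p : ℝ × ℝ,
      pderivT (fun q => -(pderivS (pderivS ψ₂) q) / ψ₂ q) p =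
        (1 / 2) * pderivS (pderivS (pderivS B)) p
          + 2 * (-(pderivS (pderivS ψ₂) p) / ψ₂ p) * pderivS B p
          + pderivS (fun q => -(pderivS (pderivS ψ₂) q) / ψ₂ q) p * B p := by
  intro p
  have smooth_diff {f : ℝ × ℝ → ℂ} (hf : ContDiff ℝ ∞ f) : Differentiable ℝ f :=
    hf.differentiable (by simp)
  have dψ := smooth_diff h₂
  have dψs := smooth_diff h₂.pderivS
  have dψss := smooth_diff h₂.pderivS.pderivS
  have dA := smooth_diff hA
  have dAs := smooth_diff hA.pderivS
  have dB := smooth_diff hB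
  have hBs : pderivS B = fun q => -2 * A q := funext hconstraint
  have hBss : pderivS (pderivS B) = fun q => -2 * pderivS A q := by
    rw [hBs, pderivS_const_mul _ dA]
  have hBsss : pderivS (pderivS (pderivS B)) = fun q => -2 * pderivS (pderivS A) q := by
    rw [hBss, pderivS_const_mul _ dAs]
  have hψst : pderivT (pderivS ψ₂) =
      fun q => B q * pderivS (pderivS ψ₂) q + (pderivS A q * ψ₂ q + -1 * (A q * pderivS ψ₂ q)) := by
    rw [pderivT_pderivS_comm h₂, funext hflow, pderivS_add (dA.fun_mul dψ) (dB.fun_mul dψs),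
      pderivS_mul dA dψ, pderivS_mul dB dψs, hBs]
    funext q
    ring
  have hψsst : pderivT (pderivS (pderivS ψ₂)) p =
      pderivS (pderivS A) p * ψ₂ p - 3 * A p * pderivS (pderivS ψ₂) p
        + B p * pderivS (pderivS (pderivS ψ₂)) p := by
    rw [pderivT_pderivS_comm h₂.pderivS, hψst,
      pderivS_add (dB.fun_mul dψss) ((dAs.fun_mul dψ).fun_add ((dA.fun_mul dψs).const_mul _)),
      pderivS_add (dAs.fun_mul dψ) ((dA.fun_mul dψs).const_mul _),
      pderivS_const_mul _ (dA.fun_mul dψs), pderivS_mul dB dψss, pderivS_mul dAs dψ,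
      pderivS_mul dA dψs, hBs]
    ring
  rw [pderivT_neg_div (dψss p) (dψ p) (hne p), pderivS_neg_div (dψss p) (dψ p) (hne p),
    hBsss, hconstraint, hψsst, hflow]
  have := hne p
  field_simp
  ring
end

section
/- (Proposition 4-3, surjectivity of the Taylor-expansion morphism; Borel–Whitney.) For every point t₀ ∈ ℝ and every sequence a : ℕ → ℂ of complex numbers, there exists a smooth (C^∞) function f : ℝ → ℂ such that the n-th iterated derivative of f at t₀ equals a(n) for every n ∈ ℕ. -/
open scoped ContDiff in
/-- A smooth compactly supported real function has bounded iterated derivatives. -/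
theorem ContDiff.exists_norm_iteratedDeriv_le_of_hasCompactSupport {g : ℝ → ℝ}
    (hg : ContDiff ℝ ∞ g) (hs : HasCompactSupport g) (k : ℕ) :
    ∃ C, 0 ≤ C ∧ ∀ x, ‖iteratedDeriv k g x‖ ≤ C := by
  obtain ⟨C, hC⟩ := (hg.continuous_iteratedFDeriv (m := k)
    (mod_cast le_top)).bounded_above_of_compact_support (hs.iteratedFDeriv k)
  refine ⟨C, (norm_nonneg _).trans (hC 0), fun x => ?_⟩
  rw [← norm_iteratedFDeriv_eq_norm_iteratedDeriv]
  exact hC x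

open scoped ContDiff in
/-- A smooth function with bounded derivatives whose Taylor series at `0` is `xⁿ / n!` and whose
derivatives of order less than `n` are uniformly small. -/
theorem exists_contDiff_taylor_monomial (n : ℕ) {ε : ℝ} (hε : 0 < ε) :
    ∃ φ : ℝ → ℝ, ContDiff ℝ ∞ φ ∧ (∀ k, iteratedDeriv k φ 0 = if k = n then 1 else 0) ∧
      (∀ k, ∃ C, ∀ x, ‖iteratedDeriv k φ x‖ ≤ C) ∧ ∀ k < n, ∀ x, ‖iteratedDeriv k φ x‖ ≤ ε := by
  let χ : ContDiffBump (0 : ℝ) := ⟨1, 2, one_pos, one_lt_two⟩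
  let g : ℝ → ℝ := fun x => χ x * (x ^ n / n.factorial)
  have hg : ContDiff ℝ ∞ g := χ.contDiff.mul (by fun_prop)
  have hgs : HasCompactSupport g := χ.hasCompactSupport.mul_right
  have hg0 (k : ℕ) : iteratedDeriv k g 0 = if k = n then 1 else 0 := by
    have h : g =ᶠ[nhds 0] fun x => x ^ n / n.factorial := by
      filter_upwards [χ.eventuallyEq_one] with x hx
      simp [g, hx]
    rw [h.iteratedDeriv_eq, iteratedDeriv_div_const, iteratedDeriv_fun_pow_zero]
    split_ifs with h1 <;> simp_all [Nat.factorial_ne_zero]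
  choose C hC0 hC using hg.exists_norm_iteratedDeriv_le_of_hasCompactSupport hgs
  let M := ∑ k ∈ Finset.range n, C k
  have hM0 : 0 ≤ M := Finset.sum_nonneg fun k _ => hC0 k
  let r := 1 + M / ε
  have hr1 : 1 ≤ r := le_add_of_nonneg_right (by positivity)
  have hr0 : 0 < r := one_pos.trans_le hr1
  have hMr : M ≤ ε * r := by
    have : ε * r = ε + M := by simp only [r]; field_simp
    linarith
  have key (k : ℕ) (x : ℝ) : iteratedDeriv k (fun x => g (r * x) / r ^ n) x =
      r ^ k * iteratedDeriv k g (r * x) / r ^ n := by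
    rw [iteratedDeriv_div_const, iteratedDeriv_comp_const_mul (hg.of_le (mod_cast le_top))]
  have hnorm (k : ℕ) (x : ℝ) : ‖iteratedDeriv k (fun x => g (r * x) / r ^ n) x‖ ≤
      r ^ k * C k / r ^ n := by
    rw [key, norm_div, norm_mul, norm_pow, norm_pow, Real.norm_of_nonneg hr0.le]
    gcongr
    exact hC k _
  refine ⟨fun x => g (r * x) / r ^ n, by fun_prop, fun k => ?_, fun k => ⟨_, hnorm k⟩,
    fun k hk x => (hnorm k x).trans ?_⟩
  · rw [key, mul_zero, hg0]
    split_ifs with h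
    · subst h
      field_simp
    · simp
  · rw [div_le_iff₀ (by positivity)]
    have hCM : C k ≤ M :=
      Finset.single_le_sum (f := C) (fun i _ => hC0 i) (Finset.mem_range.2 hk)
    calc r ^ k * C k ≤ r ^ k * (ε * r) := by gcongr; exact hCM.trans hMr
      _ = ε * r ^ (k + 1) := by ring
      _ ≤ ε * r ^ n := by gcongr; exact hk

open scoped ContDiff in
/-- **Borel's lemma** at the origin. -/
theorem exists_contDiff_iteratedDeriv_zero_eq {E : Type*} [NormedAddCommGroup E]
    [NormedSpace ℝ E] [CompleteSpace E] (a : ℕ → E) :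
    ∃ f : ℝ → E, ContDiff ℝ ∞ f ∧ ∀ n, iteratedDeriv n f 0 = a n := by
  have hε (n : ℕ) : 0 < (1 / 2 : ℝ) ^ n / (1 + ‖a n‖) := by positivity
  choose φ hφ hφ0 hφC hφε using fun n => exists_contDiff_taylor_monomial n (hε n)
  choose C hC using hφC
  have hderiv (k n : ℕ) (x : ℝ) :
      iteratedDeriv k (fun y => φ n y • a n) x = iteratedDeriv k (φ n) x • a n :=
    iteratedDeriv_smul_const ((hφ n).of_le (mod_cast le_top)).contDiffAt _
  let v : ℕ → ℕ → ℝ := fun k n => if k < n then (1 / 2) ^ n else C n k * ‖a n‖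
  have hv (k : ℕ) : Summable (v k) := by
    rw [← summable_nat_add_iff (k + 1)]
    refine ((summable_nat_add_iff (k + 1)).2 summable_geometric_two).congr fun n => ?_
    simp only [v]
    rw [if_pos (by lia)]
  have hf (n : ℕ) : ContDiff ℝ ∞ fun y => φ n y • a n := (hφ n).smul contDiff_const
  have hbound (k n : ℕ) (x : ℝ) : ‖iteratedFDeriv ℝ k (fun y => φ n y • a n) x‖ ≤ v k n := by
    rw [norm_iteratedFDeriv_eq_norm_iteratedDeriv, hderiv, norm_smul]
    simp only [v]
    split_ifs with h
    · calc _ ≤ (1 / 2 : ℝ) ^ n / (1 + ‖a n‖) * (1 + ‖a n‖) := by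
            gcongr
            · exact hφε n k h x
            · linarith
        _ = _ := div_mul_cancel₀ _ (by positivity)
    · gcongr
      exact hC n k x
  refine ⟨fun x => ∑' n, φ n x • a n,
    contDiff_tsum (N := ⊤) hf (fun k _ => hv k) fun k n x _ => hbound k n x, fun k => ?_⟩
  have hsum : Summable fun n => iteratedFDeriv ℝ k (fun y => φ n y • a n) 0 :=
    .of_norm_bounded (hv k) fun n => hbound k n 0
  rw [iteratedDeriv_eq_iteratedFDeriv, iteratedFDeriv_tsum_apply (N := ⊤) hf (fun k _ => hv k)
    (fun k n x _ => hbound k n x) le_top, ContinuousMultilinearMap.tsum_eval hsum]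
  simp_rw [← iteratedDeriv_eq_iteratedFDeriv, hderiv, hφ0]
  rw [tsum_eq_single k fun n hn => by simp [hn.symm]]
  simp

/-- Proposition 4-3 (Borel–Whitney): every formal power series is the Taylor series
of some smooth function, i.e. for any point `t₀` and any prescribed sequence of
values `a : ℕ → ℂ` there is a `C^∞` function `f : ℝ → ℂ` with
`f⁽ⁿ⁾(t₀) = a n` for all `n`. -/
theorem borel_whitney_surjective (t₀ : ℝ) (a : ℕ → ℂ) :
    ∃ f : ℝ → ℂ, ContDiff ℝ (⊤ : ℕ∞) f ∧ ∀ n : ℕ, iteratedDeriv n f t₀ = a n := by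
  obtain ⟨f, hf, hfa⟩ := exists_contDiff_iteratedDeriv_zero_eq a
  refine ⟨fun t => f (t - t₀), hf.comp (contDiff_id.sub contDiff_const), fun n => ?_⟩
  rw [iteratedDeriv_comp_sub_const]
  simp [hfa]
end
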